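/- Comparison of asymptotic variances: assume additionally that for every D ⊆ J̃ both R^D and R′^D are reversible with respect to ξ^D (ξ^D_i r^D_{ij} = ξ^D_j r^D_{ji} and ξ^D_i r′^D_{ij} = ξ^D_j r′^D_{ji} for all i, j ∈ J̃₀∖D), and that for every D the matrix R^D − R′^D is positive semidefinite in L²(ξ^D), i.e. Σ_{j∈J̃₀∖D} ξ^D_j u_j Σ_{i∈J̃₀∖D} (r^D_{ji} − r′^D_{ji}) u_i ≥ 0 for every vector u. Let ε > 0 satisfy 1 − ε·(total jump rate out of x) ≥ 0 for every state x ∈ Ẽ, and set K := Id + εQ^Z and K′ := Id + εQ^{Z′} (as operators on square-summable functions). Let f : Ẽ → ℝ be square-summable with Σ_{(D,n)} f(D,n)π̃(D,n) = 0, and assume the series Σ_{k=1}^∞ ⟨f, K^k f⟩_π̃ and Σ_{k=1}^∞ ⟨f, K′^k f⟩_π̃ both converge. Then the asymptotic variances satisfy v(f,K) := ⟨f,f⟩_π̃ + 2 Σ_{k=1}^∞ ⟨f, K^k f⟩_π̃ ≥ ⟨f,f⟩_π̃ + 2 Σ_{k=1}^∞ ⟨f, K′^k f⟩_π̃ =: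 v(f,K′). -/

import Mathlib

open scoped BigOperators

noncomputable section

namespace UnrelNet

/-- State space of the unreliable Jackson network: a set of broken-down nodes
together with a queue-length vector. -/
abbrev Est (J : ℕ) := Finset (Fin J) × (Fin J → ℕ)

/-- The extended node set `J̃₀ ∖ D`: the exterior node `none` together with
the up nodes (complement of `D`). -/
def ext (J : ℕ) (D : Finset (Fin J)) : Finset (Option (Fin J)) :=
  insert none (Dᶜ.image Option.some)

/-- Unit vector `e_j` of `ℕ^J̃`, with `e_0 = 0` (index `none`). -/
def eV {J : ℕ} (o : Option (Fin J)) : Fin J → ℕ := fun i =>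
  match o with
  | none => 0
  | some j => if i = j then 1 else 0

/-- Breakdown/repair generator `Q^Y`. -/
def QY {J : ℕ} (A B : Finset (Fin J) → ℝ) (f : Finset (Fin J) → ℝ)
    (D : Finset (Fin J)) : ℝ :=
  (∑ H ∈ Finset.univ.filter (fun H => H ⊂ D), B D / B H * (f H - f D))
    + ∑ I ∈ Finset.univ.filter (fun I => D ⊂ I), A I / A D * (f I - f D)

/-- Off-diagonal breakdown/repair rates. -/
def qY0 {J : ℕ} (A B : Finset (Fin J) → ℝ) (D E : Finset (Fin J)) : ℝ :=
  if D ⊂ E then A E / A D else if E ⊂ D then B D / B E else 0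

/-- Breakdown/repair rate matrix `q^Y`, including the diagonal. -/
def qY {J : ℕ} (A B : Finset (Fin J) → ℝ) (D E : Finset (Fin J)) : ℝ :=
  if E = D then -∑ F, qY0 A B D F else qY0 A B D E

/-- Breakdown/repair generator written via the rate matrix. -/
def QYm {J : ℕ} (A B : Finset (Fin J) → ℝ) (f : Finset (Fin J) → ℝ)
    (D : Finset (Fin J)) : ℝ :=
  ∑ E, qY A B D E * f E

/-- Normalisation constant `Ĉ`. -/
def Chat {J : ℕ} (A B : Finset (Fin J) → ℝ) : ℝ := ∑ D, A D / B D

/-- Stationary distribution `π̂` of the breakdown/repair process. -/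
def piY {J : ℕ} (A B : Finset (Fin J) → ℝ) (D : Finset (Fin J)) : ℝ :=
  (A D / B D) / Chat A B

/-- `Π_{i=1}^{k} η_j/μ_j(i)`. -/
def prodK {J : ℕ} (η : Fin J → ℝ) (μ : Fin J → ℕ → ℝ) (j : Fin J) (k : ℕ) : ℝ :=
  ∏ i ∈ Finset.range k, η j / μ j (i + 1)

/-- Normalisation constant `C_j`. -/
def Cnorm {J : ℕ} (η : Fin J → ℝ) (μ : Fin J → ℕ → ℝ) (j : Fin J) : ℝ :=
  ∑' k : ℕ, prodK η μ j k

/-- Product-form stationary distribution `π` of the Jackson network. -/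
def piX {J : ℕ} (η : Fin J → ℝ) (μ : Fin J → ℕ → ℝ) (n : Fin J → ℕ) : ℝ :=
  ∏ j, prodK η μ j (n j) / Cnorm η μ j

/-- Product measure `π̃(D,n) = π̂(D)·π(n)`. -/
def piZ {J : ℕ} (η : Fin J → ℝ) (μ : Fin J → ℕ → ℝ) (A B : Finset (Fin J) → ℝ)
    (x : Est J) : ℝ :=
  piY A B x.1 * piX η μ x.2

/-- Generator `Q^Z` of the unreliable Jackson network. -/
def QZ {J : ℕ} (lam : ℝ) (μ : Fin J → ℕ → ℝ)
    (r : Finset (Fin J) → Option (Fin J) → Option (Fin J) → ℝ)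
    (A B : Finset (Fin J) → ℝ) (f : Est J → ℝ) (x : Est J) : ℝ :=
  (∑ j ∈ x.1ᶜ, lam * r x.1 none (some j) * (f (x.1, x.2 + eV (some j)) - f x))
    + (∑ j ∈ x.1ᶜ, μ j (x.2 j) * r x.1 (some j) none * (f (x.1, x.2 - eV (some j)) - f x))
    + (∑ j ∈ x.1ᶜ, ∑ i ∈ x.1ᶜ,
        μ j (x.2 j) * r x.1 (some j) (some i) * (f (x.1, x.2 - eV (some j) + eV (some i)) - f x))
    + (∑ H ∈ Finset.univ.filter (fun H => H ⊂ x.1), B x.1 / B H * (f (H, x.2) - f x))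
    + ∑ I ∈ Finset.univ.filter (fun I => x.1 ⊂ I), A I / A x.1 * (f (I, x.2) - f x)

/-- Transition-rate matrix `q^Z` of the unreliable Jackson network
(between distinct states; the diagonal is set to `0`). -/
def qZ {J : ℕ} (lam : ℝ) (μ : Fin J → ℕ → ℝ)
    (r : Finset (Fin J) → Option (Fin J) → Option (Fin J) → ℝ)
    (A B : Finset (Fin J) → ℝ) (x y : Est J) : ℝ :=
  if x = y then 0
  else
    (if y.1 = x.1 then
        ∑ j ∈ x.1ᶜ,
          ((if y.2 = x.2 + eV (some j) then lam * r x.1 none (some j) else 0)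
            + (if y.2 + eV (some j) = x.2 then μ j (x.2 j) * r x.1 (some j) none else 0)
            + ∑ i ∈ x.1ᶜ,
                if i ≠ j ∧ y.2 + eV (some j) = x.2 + eV (some i) then
                  μ j (x.2 j) * r x.1 (some j) (some i)
                else 0)
      else 0)
    + (if y.2 = x.2 then
        (if y.1 ⊂ x.1 then B x.1 / B y.1 else 0) + (if x.1 ⊂ y.1 then A y.1 / A x.1 else 0)
      else 0)

/-- Extension `η^D` of the traffic solution: `η^D_0 = λ`, `η^D_j = η_j`. -/
def etaE {J : ℕ} (lam : ℝ) (η : Fin J → ℝ) : Option (Fin J) → ℝ := fun o => o.elim lam η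

/-- Normalised routing-equilibrium vector `ξ^D`. -/
def xiV {J : ℕ} (lam : ℝ) (η : Fin J → ℝ) (D : Finset (Fin J))
    (o : Option (Fin J)) : ℝ :=
  etaE lam η o / ∑ k ∈ ext J D, etaE lam η k

/-- Spectral gap of a generator on the network state space w.r.t. a measure `m`. -/
def GapZ {J : ℕ} (m : Est J → ℝ) (Q : (Est J → ℝ) → Est J → ℝ) : ℝ :=
  sInf {v : ℝ | ∃ f : Est J → ℝ,
    Summable (fun x => f x * f x * m x) ∧ (∑' x, f x * m x) = 0 ∧
      (∑' x, f x * f x * m x) = 1 ∧ v = ∑' x, f x * -(Q f x) * m x}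

/-- Spectral gap of a generator on `2^{J̃}` w.r.t. a probability vector `m`. -/
def GapY {J : ℕ} (m : Finset (Fin J) → ℝ)
    (Q : (Finset (Fin J) → ℝ) → Finset (Fin J) → ℝ) : ℝ :=
  sInf {v : ℝ | ∃ f : Finset (Fin J) → ℝ,
    (∑ D, m D * f D) = 0 ∧ (∑ D, m D * f D ^ 2) = 1 ∧
      v = -(∑ D, m D * f D * Q f D)}

/-- Merge a vector indexed by `D` with a vector indexed by `J̃∖D`. -/
def merge {J : ℕ} (D : Finset (Fin J)) (a : {j : Fin J // j ∈ D} → ℕ)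
    (b : {j : Fin J // j ∉ D} → ℕ) : Fin J → ℕ := fun j =>
  if h : j ∈ D then a ⟨j, h⟩ else b ⟨j, h⟩

/-- Marginal product-form density on a sub-collection of nodes. -/
def piSub {J : ℕ} (η : Fin J → ℝ) (μ : Fin J → ℕ → ℝ) (p : Fin J → Prop)
    [DecidablePred p] (a : {j : Fin J // p j} → ℕ) : ℝ :=
  ∏ j : {j : Fin J // p j}, prodK η μ j.1 (a j) / Cnorm η μ j.1

/-- Unit vector on a subtype index set. -/
def eS {J : ℕ} {p : Fin J → Prop} (j : {k : Fin J // p k}) :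
    {k : Fin J // p k} → ℕ := fun i => if i = j then 1 else 0

/-- Generator of the synthetic subnetwork on the up nodes `J̃∖D`. -/
def QXsub {J : ℕ} (lam : ℝ) (μ : Fin J → ℕ → ℝ)
    (r : Finset (Fin J) → Option (Fin J) → Option (Fin J) → ℝ)
    (D : Finset (Fin J)) (h : ({j : Fin J // j ∉ D} → ℕ) → ℝ)
    (m : {j : Fin J // j ∉ D} → ℕ) : ℝ :=
  (∑ j : {j : Fin J // j ∉ D}, lam * r D none (some j.1) * (h (m + eS j) - h m))
    + (∑ j : {j : Fin J // j ∉ D}, μ j.1 (m j) * r D (some j.1) none * (h (m - eS j) - h m))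
    + ∑ j : {j : Fin J // j ∉ D}, ∑ i : {j : Fin J // j ∉ D},
        μ j.1 (m j) * r D (some j.1) (some i.1) * (h (m - eS j + eS i) - h m)

/-- Transition-rate matrix `q^X` of the (reliable) Jackson network. -/
def qX {J : ℕ} (lam : ℝ) (μ : Fin J → ℕ → ℝ)
    (r : Option (Fin J) → Option (Fin J) → ℝ) (n m : Fin J → ℕ) : ℝ :=
  if n = m then 0
  else
    ∑ j : Fin J,
      ((if m = n + eV (some j) then lam * r none (some j) else 0)
        + (if m + eV (some j) = n then μ j (n j) * r (some j) none else 0)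
        + ∑ i : Fin J,
            if i ≠ j ∧ m + eV (some j) = n + eV (some i) then
              μ j (n j) * r (some j) (some i)
            else 0)

/-- One-step Markov operator `K = Id + ε·Q`. -/
def Kop {J : ℕ} (ε : ℝ) (Q : (Est J → ℝ) → Est J → ℝ) :
    (Est J → ℝ) → Est J → ℝ := fun h x => h x + ε * Q h x

section aux
open Filter Topology

theorem abs_cmp {V : Type*} [AddCommGroup V] [Module ℝ V] (B : V →ₗ[ℝ] V →ₗ[ℝ] ℝ)
    (hs : ∀ u v, B u v = B v u) (hp : ∀ u, 0 ≤ B u u) (T T' : V →ₗ[ℝ] V)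
    (hT : ∀ u v, B (T u) v = B u (T v)) (hT' : ∀ u v, B (T' u) v = B u (T' v))
    (h1 : ∀ u, B u (T u) ≤ B u u) (h2 : ∀ u, B u (T' u) ≤ B u (T u)) (f : V)
    (hc : Summable (fun k : ℕ => B f ((T ^ (k+1)) f)))
    (hc' : Summable (fun k : ℕ => B f ((T' ^ (k+1)) f))) :
    ∑' k : ℕ, B f ((T' ^ (k+1)) f) ≤ ∑' k : ℕ, B f ((T ^ (k+1)) f) := by
  have cs : ∀ u v, (B u v)^2 ≤ B u u * B v v := by
    intro u v
    have h : ∀ t : ℝ, 0 ≤ B u u * (t * t) + (2 * B u v) * t + B v v := by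
      intro t
      have := hp (t • u + v)
      simp only [map_add, map_smul, LinearMap.add_apply, LinearMap.smul_apply, smul_eq_mul] at this
      rw [hs v u] at this
      linarith
    have := discrim_le_zero h
    unfold discrim at this
    nlinarith
  have gen : ∀ (S : V →ₗ[ℝ] V), (∀ u v, B (S u) v = B u (S v)) → ∀ a b : ℕ,
      B ((S ^ a) f) ((S ^ b) f) = B f ((S ^ (a+b)) f) := by
    intro S hS a
    induction a with
    | zero => intro b; simp
    | succ a ih =>
      intro b
      rw [pow_succ', Module.End.mul_apply, hS, ← Module.End.mul_apply, ← pow_succ', ih]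
      congr 3; ring
  have tel : ∀ (S : V →ₗ[ℝ] V) (N : ℕ), (∑ k ∈ Finset.range N, (S ^ k) f) -
      S (∑ k ∈ Finset.range N, (S ^ k) f) = f - (S ^ N) f := by
    intro S N
    rw [map_sum, ← Finset.sum_sub_distrib]
    have : ∀ k, (S ^ k) f - S ((S ^ k) f) = (S ^ k) f - (S ^ (k+1)) f := by
      intro k; rw [pow_succ', Module.End.mul_apply]
    simp only [this]
    rw [Finset.sum_range_sub' (fun k => (S ^ k) f)]
    simp
  have key : ∀ N M : ℕ, 0 ≤ 2 * ∑ k ∈ Finset.range N, B f ((T ^ k) f)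
      - ∑ k ∈ Finset.range (N+N), B f ((T ^ k) f)
      + 2 * B ((T ^ N) f) (∑ k ∈ Finset.range M, (T' ^ k) f)
      - ∑ k ∈ Finset.range (M+M), B f ((T' ^ k) f) := by
    intro N M
    have q : ∀ (S : V →ₗ[ℝ] V), (∀ u v, B (S u) v = B u (S v)) → ∀ N : ℕ,
       B (∑ k ∈ Finset.range N, (S ^ k) f) (∑ k ∈ Finset.range N, (S ^ k) f) -
       B (∑ k ∈ Finset.range N, (S ^ k) f) (S (∑ k ∈ Finset.range N, (S ^ k) f)) =
       2 * ∑ k ∈ Finset.range N, B f ((S ^ k) f) - ∑ k ∈ Finset.range (N+N), B f ((S ^ k) f) := by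
      intro S hS N
      rw [← map_sub, tel, hs, map_sub, LinearMap.sub_apply, map_sum, map_sum]
      simp only [gen S hS]
      rw [Finset.sum_range_add]
      ring
    have qg := q T hT N
    have qh := q T' hT' M
    have tg := tel T N
    set g := ∑ k ∈ Finset.range N, (T ^ k) f
    have ph : B f (∑ k ∈ Finset.range M, (T' ^ k) f) = ∑ k ∈ Finset.range M, B f ((T' ^ k) f) := by
      rw [map_sum]
    set h := ∑ k ∈ Finset.range M, (T' ^ k) f
    have e1 := h1 (g - h)
    have e2 := h2 h
    have e3 : B (g - T g) h = B f h - B ((T ^ N) f) h := by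
      rw [tg, map_sub, LinearMap.sub_apply]
    simp only [map_sub, LinearMap.sub_apply] at e1 e3
    have e4 := hT g h
    have e5 : B h (T g) = B g (T h) := by rw [← hT, hs]
    have e6 := hs g h
    have e7 : B h h - B h (T h) ≤ B h h - B h (T' h) := by linarith
    linarith
  have hC : Summable (fun k : ℕ => B f ((T ^ k) f)) := (summable_nat_add_iff 1).1 hc
  have hC' : Summable (fun k : ℕ => B f ((T' ^ k) f)) := (summable_nat_add_iff 1).1 hc'
  have dbl : Tendsto (fun n : ℕ => n + n) atTop atTop :=
    tendsto_atTop_mono (fun n => Nat.le_add_left n n) tendsto_id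
  have t1 := hC.hasSum.tendsto_sum_nat
  have t1' := hC'.hasSum.tendsto_sum_nat
  have small : ∀ h, Tendsto (fun N => B ((T ^ N) f) h) atTop (𝓝 0) := by
    intro h
    have z : Tendsto (fun N : ℕ => B f ((T ^ (N+N)) f) * B h h) atTop (𝓝 0) := by
      simpa using (hC.tendsto_atTop_zero.comp dbl).mul_const (B h h)
    have z2 : Tendsto (fun N : ℕ => (B ((T ^ N) f) h)^2) atTop (𝓝 0) := by
      refine squeeze_zero (fun _ => sq_nonneg _) (fun N => ?_) z
      rw [← gen T hT]; exact cs _ _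
    have z3 := z2.sqrt
    simp only [Real.sqrt_sq_eq_abs, Real.sqrt_zero] at z3
    exact (tendsto_zero_iff_abs_tendsto_zero _).2 z3
  have hle : ∀ M : ℕ, ∑ k ∈ Finset.range (M+M), B f ((T' ^ k) f) ≤ ∑' k, B f ((T ^ k) f) := by
    intro M
    have lim := (((t1.const_mul 2).sub (t1.comp dbl)).add
      ((small (∑ k ∈ Finset.range M, (T' ^ k) f)).const_mul 2)).sub_const
      (∑ k ∈ Finset.range (M+M), B f ((T' ^ k) f))
    have := ge_of_tendsto' lim (fun N => key N M)
    linarith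
  have fin := le_of_tendsto' (t1'.comp dbl) hle
  rw [hC.tsum_eq_zero_add, hC'.tsum_eq_zero_add] at fin
  simpa using fin

theorem form_symm {ι : Type*} [Fintype ι] (c : ι → ι → ℝ) (hc : ∀ i j, c i j = c j i) (u v : ι → ℝ) :
    ∑ j, ∑ i, c j i * (v j * (u i - u j)) = ∑ j, ∑ i, c j i * (u j * (v i - v j)) := by
  have : ∑ j, ∑ i, c j i * (v j * u i) = ∑ j, ∑ i, c j i * (u j * v i) := by
    rw [Finset.sum_comm]
    refine Finset.sum_congr rfl fun i _ => Finset.sum_congr rfl fun j _ => ?_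
    rw [hc]; ring
  simp only [mul_sub, Finset.sum_sub_distrib]
  rw [this]
  congr 1
  refine Finset.sum_congr rfl fun i _ => Finset.sum_congr rfl fun j _ => ?_
  ring

theorem form_nonpos {ι : Type*} [Fintype ι] (c : ι → ι → ℝ) (hc : ∀ i j, c i j = c j i)
    (h0 : ∀ i j, 0 ≤ c i j) (u : ι → ℝ) :
    ∑ j, ∑ i, c j i * (u j * (u i - u j)) ≤ 0 := by
  have h : ∑ j, ∑ i, c j i * (u j * (u i - u j)) = ∑ j, ∑ i, c j i * (u i * (u j - u i)) := by
    rw [Finset.sum_comm]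
    refine Finset.sum_congr rfl fun i _ => Finset.sum_congr rfl fun j _ => ?_
    rw [hc]
  have h2 : ∑ j, ∑ i, c j i * (u j * (u i - u j)) + ∑ j, ∑ i, c j i * (u i * (u j - u i)) ≤ 0 := by
    rw [← Finset.sum_add_distrib]
    refine Finset.sum_nonpos fun j _ => ?_
    rw [← Finset.sum_add_distrib]
    refine Finset.sum_nonpos fun i _ => ?_
    nlinarith [mul_nonneg (h0 j i) (sq_nonneg (u i - u j))]
  linarith

def L2 {α : Type*} (w : α → ℝ) (hw : ∀ x, 0 ≤ w x) : Submodule ℝ (α → ℝ) where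
  carrier := {f | Summable (fun x => f x * f x * w x)}
  zero_mem' := by simp
  add_mem' := by
    intro f g hf hg
    refine Summable.of_nonneg_of_le (fun x => mul_nonneg (mul_self_nonneg _) (hw x)) (fun x => ?_)
      ((Summable.add hf hg).mul_left 2)
    simp only [Pi.add_apply]
    nlinarith [mul_nonneg (mul_self_nonneg (f x - g x)) (hw x)]
  smul_mem' := by
    intro c f hf
    refine (Summable.mul_left (c*c) hf).congr (fun x => ?_)
    simp only [Pi.smul_apply, smul_eq_mul]; ring

theorem L2_mul {α : Type*} {w : α → ℝ} (hw : ∀ x, 0 ≤ w x) {f g : α → ℝ}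
    (hf : f ∈ L2 w hw) (hg : g ∈ L2 w hw) : Summable (fun x => f x * g x * w x) := by
  refine Summable.of_norm_bounded (Summable.add hf hg) (fun x => ?_)
  rw [Real.norm_eq_abs, abs_le]
  constructor
  · nlinarith [mul_nonneg (mul_self_nonneg (f x + g x)) (hw x),
      mul_nonneg (mul_self_nonneg (f x)) (hw x), mul_nonneg (mul_self_nonneg (g x)) (hw x)]
  · nlinarith [mul_nonneg (mul_self_nonneg (f x - g x)) (hw x),
      mul_nonneg (mul_self_nonneg (f x)) (hw x), mul_nonneg (mul_self_nonneg (g x)) (hw x)]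

theorem L2_bdd {α : Type*} {w : α → ℝ} (hw : ∀ x, 0 ≤ w x) {f b : α → ℝ} {C : ℝ}
    (hb : ∀ x, |b x| ≤ C) (hf : f ∈ L2 w hw) : (fun x => b x * f x) ∈ L2 w hw := by
  refine Summable.of_nonneg_of_le (fun x => mul_nonneg (mul_self_nonneg _) (hw x)) (fun x => ?_)
      (Summable.mul_left (C^2) hf)
  have h1 : b x * b x ≤ C^2 := by
    have := sq_le_sq' (by linarith [(abs_nonneg (b x)).trans (hb x), abs_nonneg (b x)]) (hb x)
    rw [sq_abs] at this; linarith
  have := mul_le_mul_of_nonneg_right h1 (mul_nonneg (mul_self_nonneg (f x)) (hw x))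
  calc _ = b x * b x * (f x * f x * w x) := by ring
    _ ≤ _ := this

def ipB {α : Type*} (w : α → ℝ) (hw : ∀ x, 0 ≤ w x) : L2 w hw →ₗ[ℝ] L2 w hw →ₗ[ℝ] ℝ :=
  LinearMap.mk₂ ℝ (fun f g => ∑' x, f.1 x * g.1 x * w x)
    (by
      intro f f' g
      rw [← (L2_mul hw f.2 g.2).tsum_add (L2_mul hw f'.2 g.2)]
      congr 1; ext x; simp; ring)
    (by
      intro c f g
      rw [smul_eq_mul, ← tsum_mul_left]
      congr 1; ext x; simp; ring)
    (by
      intro f g g'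
      rw [← (L2_mul hw f.2 g.2).tsum_add (L2_mul hw f.2 g'.2)]
      congr 1; ext x; simp; ring)
    (by
      intro c f g
      rw [smul_eq_mul, ← tsum_mul_left]
      congr 1; ext x; simp; ring)

theorem ipB_apply {α : Type*} (w : α → ℝ) (hw : ∀ x, 0 ≤ w x) (f g : L2 w hw) :
    ipB w hw f g = ∑' x, f.1 x * g.1 x * w x := rfl

def Up {J : ℕ} (ρ : Finset (Fin J) → Option (Fin J) → Option (Fin J) → ℝ)
    (ν : Option (Fin J) → Est J → ℝ) (f : Est J → ℝ) (x : Est J) : ℝ :=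
  ∑ j, ∑ i, ρ x.1 j i * (ν j x * f (x.1, x.2 - eV j + eV i) - ν j x * f x)

theorem fin_bdd {β : Type*} [Finite β] (b : β → ℝ) : ∃ C, ∀ x, |b x| ≤ C := by
  obtain ⟨C, hC⟩ := (Set.finite_range (fun x => |b x|)).bddAbove
  exact ⟨C, fun x => hC ⟨x, rfl⟩⟩

section up
variable {J : ℕ} {w : Est J → ℝ} (hw : ∀ x, 0 ≤ w x) {ν : Option (Fin J) → Est J → ℝ}
  {e : Option (Fin J) → ℝ}

theorem L2_shift (he : ∀ o, 0 < e o)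
    (hsh : ∀ (o : Option (Fin J)) (G : Est J → ℝ) (a : ℝ), HasSum (fun x : Est J => ν o x * G x * w x) a ↔
      HasSum (fun x : Est J => e o * G (x.1, x.2 + eV o) * w x) a)
    {M : ℝ} (hν : ∀ o x, |ν o x| ≤ M) {f : Est J → ℝ} (hf : f ∈ L2 w hw) (o : Option (Fin J)) :
    (fun x : Est J => f (x.1, x.2 + eV o)) ∈ L2 w hw := by
  have h1 : Summable (fun x => ν o x * (f x * f x) * w x) := by
    refine Summable.of_norm_bounded (Summable.mul_left M hf) (fun x => ?_)
    have h0 := mul_nonneg (mul_self_nonneg (f x)) (hw x)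
    rw [mul_assoc, norm_mul, Real.norm_eq_abs, Real.norm_eq_abs, abs_of_nonneg h0]
    exact mul_le_mul_of_nonneg_right (hν o x) h0
  have h2 := ((hsh o (fun x => f x * f x) _).1 h1.hasSum).summable
  refine (h2.mul_left (e o)⁻¹).congr (fun x => ?_)
  have := (he o).ne'
  field_simp

theorem L2_move (he : ∀ o, 0 < e o)
    (hsh : ∀ (o : Option (Fin J)) (G : Est J → ℝ) (a : ℝ), HasSum (fun x : Est J => ν o x * G x * w x) a ↔
      HasSum (fun x : Est J => e o * G (x.1, x.2 + eV o) * w x) a)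
    {M : ℝ} (hν : ∀ o x, |ν o x| ≤ M) {f : Est J → ℝ} (hf : f ∈ L2 w hw) (j i : Option (Fin J)) :
    (fun x : Est J => ν j x * f (x.1, x.2 - eV j + eV i)) ∈ L2 w hw := by
  have h1 : Summable (fun x : Est J => e j * (ν j (x.1, x.2 + eV j) *
      (f (x.1, x.2 + eV i) * f (x.1, x.2 + eV i))) * w x) := by
    refine Summable.of_norm_bounded
      (Summable.mul_left (e j * M) (L2_shift hw he hsh hν hf i)) (fun x => ?_)
    have h0 := mul_nonneg (mul_self_nonneg (f (x.1, x.2 + eV i))) (hw x)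
    have : e j * (ν j (x.1, x.2 + eV j) *
      (f (x.1, x.2 + eV i) * f (x.1, x.2 + eV i))) * w x = e j * ν j (x.1, x.2 + eV j) *
      (f (x.1, x.2 + eV i) * f (x.1, x.2 + eV i) * w x) := by ring
    rw [this, norm_mul, norm_mul, Real.norm_eq_abs, Real.norm_eq_abs, Real.norm_eq_abs,
      abs_of_nonneg h0, abs_of_pos (he j)]
    exact mul_le_mul_of_nonneg_right (mul_le_mul_of_nonneg_left (hν _ _) (he j).le) h0
  have h2 := ((hsh j (fun x => ν j x * (f (x.1, x.2 - eV j + eV i) * f (x.1, x.2 - eV j + eV i)))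
    _).2 (by simpa only [add_tsub_cancel_right] using h1.hasSum)).summable
  refine h2.congr (fun x => ?_)
  ring

theorem L2_Up_term (he : ∀ o, 0 < e o)
    (hsh : ∀ (o : Option (Fin J)) (G : Est J → ℝ) (a : ℝ), HasSum (fun x : Est J => ν o x * G x * w x) a ↔
      HasSum (fun x : Est J => e o * G (x.1, x.2 + eV o) * w x) a)
    {M : ℝ} (hν : ∀ o x, |ν o x| ≤ M)
    (ρ : Finset (Fin J) → Option (Fin J) → Option (Fin J) → ℝ)
    {f : Est J → ℝ} (hf : f ∈ L2 w hw) (j i : Option (Fin J)) :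
    (fun x : Est J => ρ x.1 j i * (ν j x * f (x.1, x.2 - eV j + eV i) - ν j x * f x)) ∈ L2 w hw := by
  obtain ⟨C, hC⟩ := fin_bdd (fun D => ρ D j i)
  exact L2_bdd hw (b := fun x : Est J => ρ x.1 j i) (fun x => hC x.1)
    ((L2 w hw).sub_mem (L2_move hw he hsh hν hf j i) (L2_bdd hw (hν j) hf))

theorem L2_Up (he : ∀ o, 0 < e o)
    (hsh : ∀ (o : Option (Fin J)) (G : Est J → ℝ) (a : ℝ), HasSum (fun x : Est J => ν o x * G x * w x) a ↔
      HasSum (fun x : Est J => e o * G (x.1, x.2 + eV o) * w x) a)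
    {M : ℝ} (hν : ∀ o x, |ν o x| ≤ M)
    (ρ : Finset (Fin J) → Option (Fin J) → Option (Fin J) → ℝ)
    {f : Est J → ℝ} (hf : f ∈ L2 w hw) : Up ρ ν f ∈ L2 w hw := by
  have := (L2 w hw).sum_mem (t := Finset.univ) (fun j _ => (L2 w hw).sum_mem (t := Finset.univ)
    (fun i _ => L2_Up_term hw he hsh hν ρ hf j i))
  convert this using 1
  ext x
  simp [Up]

theorem Up_hasSum (he : ∀ o, 0 < e o)
    (hsh : ∀ (o : Option (Fin J)) (G : Est J → ℝ) (a : ℝ), HasSum (fun x : Est J => ν o x * G x * w x) a ↔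
      HasSum (fun x : Est J => e o * G (x.1, x.2 + eV o) * w x) a)
    {M : ℝ} (hν : ∀ o x, |ν o x| ≤ M)
    (ρ : Finset (Fin J) → Option (Fin J) → Option (Fin J) → ℝ)
    {f g : Est J → ℝ} (hf : f ∈ L2 w hw) (hg : g ∈ L2 w hw) :
    HasSum (fun x : Est J => (∑ j, ∑ i, (e j * ρ x.1 j i) * (g (x.1, x.2 + eV j) *
      (f (x.1, x.2 + eV i) - f (x.1, x.2 + eV j)))) * w x) (∑' x, g x * Up ρ ν f x * w x) := by
  have h1 : ∀ j i, ∃ a, HasSum (fun x => g x *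
      (ρ x.1 j i * (ν j x * f (x.1, x.2 - eV j + eV i) - ν j x * f x)) * w x) a := fun j i =>
    (L2_mul hw hg (L2_Up_term hw he hsh hν ρ hf j i))
  choose a ha using h1
  have hb : ∀ j i, HasSum (fun x : Est J => ((e j * ρ x.1 j i) * (g (x.1, x.2 + eV j) *
      (f (x.1, x.2 + eV i) - f (x.1, x.2 + eV j)))) * w x) (a j i) := by
    intro j i
    have := (hsh j (fun x => ρ x.1 j i * g x * (f (x.1, x.2 - eV j + eV i) - f x)) (a j i)).1
      (by refine (ha j i).congr_fun ?_
          intro x; ring)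
    refine this.congr_fun ?_
    intro x
    simp only [add_tsub_cancel_right]
    ring
  have ha' := hasSum_sum (s := Finset.univ) (fun j _ => hasSum_sum (s := Finset.univ) (fun i _ => ha j i))
  have hb' := hasSum_sum (s := Finset.univ) (fun j _ => hasSum_sum (s := Finset.univ) (fun i _ => hb j i))
  have : (∑' x, g x * Up ρ ν f x * w x) = ∑ j, ∑ i, a j i := by
    rw [← ha'.tsum_eq]
    congr 1; ext x
    simp only [Up, Finset.mul_sum, Finset.sum_mul]
  rw [this]
  convert hb' using 1
  ext x
  simp only [Finset.sum_mul]

end up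

def Yo {J : ℕ} (y : Finset (Fin J) → Finset (Fin J) → ℝ) (f : Est J → ℝ) (x : Est J) : ℝ :=
  ∑ E, y x.1 E * (f (E, x.2) - f x)

section yy
variable {J : ℕ} {p : Finset (Fin J) → ℝ} {q : (Fin J → ℕ) → ℝ}

theorem L2_Y (hp : ∀ D, 0 < p D) (hw : ∀ x : Est J, 0 ≤ p x.1 * q x.2)
    (y : Finset (Fin J) → Finset (Fin J) → ℝ)
    {f : Est J → ℝ} (hf : f ∈ L2 (fun x : Est J => p x.1 * q x.2) hw) :
    Yo y f ∈ L2 (fun x : Est J => p x.1 * q x.2) hw := by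
  have h1 : ∀ E, (fun x : Est J => f (E, x.2)) ∈ L2 (fun x : Est J => p x.1 * q x.2) hw := by
    intro E
    refine (summable_prod_of_nonneg (fun x => mul_nonneg (mul_self_nonneg _) (hw x))).2
      ⟨fun D => ?_, Summable.of_finite⟩
    have h2 : Summable (fun n => f (E, n) * f (E, n) * (p E * q n)) := Summable.prod_factor hf E
    refine (h2.mul_left (p D / p E)).congr (fun n => ?_)
    have := (hp E).ne'
    simp only
    field_simp
  have := (L2 _ hw).sum_mem (t := Finset.univ) (fun E _ => by
    obtain ⟨C, hC⟩ := fin_bdd (fun D => y D E)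
    exact L2_bdd hw (b := fun x : Est J => y x.1 E) (fun x => hC x.1)
      ((L2 _ hw).sub_mem (h1 E) hf))
  convert this using 1
  ext x
  simp [Yo]

theorem Y_eq (hp : ∀ D, 0 < p D) (hw : ∀ x : Est J, 0 ≤ p x.1 * q x.2)
    (y : Finset (Fin J) → Finset (Fin J) → ℝ)
    {f g : Est J → ℝ} (hf : f ∈ L2 (fun x : Est J => p x.1 * q x.2) hw)
    (hg : g ∈ L2 (fun x : Est J => p x.1 * q x.2) hw) :
    ∑' x : Est J, g x * Yo y f x * (p x.1 * q x.2) =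
    ∑' n, (∑ D, ∑ E, (p D * y D E) * (g (D, n) * (f (E, n) - f (D, n)))) * q n := by
  have hs := L2_mul hw hg (L2_Y hp hw y hf)
  rw [← (Equiv.prodComm _ _).tsum_eq]
  have hs' := hs.prod_symm
  have := hs'.tsum_prod
  simp only [Equiv.prodComm_apply]
  refine this.trans ?_
  congr 1; ext n
  rw [tsum_fintype, Finset.sum_mul]
  refine Finset.sum_congr rfl fun D _ => ?_
  simp only [Yo, Prod.swap, Finset.mul_sum, Finset.sum_mul]
  refine Finset.sum_congr rfl fun E _ => ?_
  ring

end yy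

section total
variable {J : ℕ} {p : Finset (Fin J) → ℝ} {q : (Fin J → ℕ) → ℝ}
  {ν : Option (Fin J) → Est J → ℝ} {e : Option (Fin J) → ℝ}

def Tot (ρ : Finset (Fin J) → Option (Fin J) → Option (Fin J) → ℝ)
    (ν : Option (Fin J) → Est J → ℝ) (y : Finset (Fin J) → Finset (Fin J) → ℝ) (ε : ℝ) :
    (Est J → ℝ) →ₗ[ℝ] (Est J → ℝ) where
  toFun f := fun x => f x + ε * (Up ρ ν f x + Yo y f x)
  map_add' := by
    intro f g
    ext x
    have h1 : Up ρ ν (f + g) x = Up ρ ν f x + Up ρ ν g x := by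
      simp only [Up, ← Finset.sum_add_distrib, Pi.add_apply]
      refine Finset.sum_congr rfl fun _ _ => Finset.sum_congr rfl fun _ _ => ?_
      ring
    have h2 : Yo y (f + g) x = Yo y f x + Yo y g x := by
      simp only [Yo, ← Finset.sum_add_distrib, Pi.add_apply]
      refine Finset.sum_congr rfl fun _ _ => ?_
      ring
    simp only [Pi.add_apply, h1, h2]
    ring
  map_smul' := by
    intro c f
    ext x
    have h1 : Up ρ ν (c • f) x = c * Up ρ ν f x := by
      simp only [Up, Finset.mul_sum, Pi.smul_apply, smul_eq_mul]
      refine Finset.sum_congr rfl fun _ _ => Finset.sum_congr rfl fun _ _ => ?_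
      ring
    have h2 : Yo y (c • f) x = c * Yo y f x := by
      simp only [Yo, Finset.mul_sum, Pi.smul_apply, smul_eq_mul]
      refine Finset.sum_congr rfl fun _ _ => ?_
      ring
    simp only [Pi.smul_apply, smul_eq_mul, h1, h2, RingHom.id_apply]
    ring

theorem total_cmp (hp : ∀ D, 0 < p D) (hq : ∀ n, 0 ≤ q n) (he : ∀ o, 0 < e o)
    (hsh : ∀ (o : Option (Fin J)) (G : Est J → ℝ) (a : ℝ),
      HasSum (fun x : Est J => ν o x * G x * (p x.1 * q x.2)) a ↔
      HasSum (fun x : Est J => e o * G (x.1, x.2 + eV o) * (p x.1 * q x.2)) a)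
    {M : ℝ} (hν : ∀ o x, |ν o x| ≤ M)
    (ρ ρ' : Finset (Fin J) → Option (Fin J) → Option (Fin J) → ℝ)
    (y : Finset (Fin J) → Finset (Fin J) → ℝ)
    (hy0 : ∀ D E, 0 ≤ y D E) (hys : ∀ D E, p D * y D E = p E * y E D)
    (h0 : ∀ D i j, 0 ≤ ρ D i j)
    (hr : ∀ D i j, e i * ρ D i j = e j * ρ D j i)
    (hr' : ∀ D i j, e i * ρ' D i j = e j * ρ' D j i)
    (hcmp : ∀ D (u : Option (Fin J) → ℝ), ∑ j, ∑ i, (e j * ρ' D j i) * (u j * (u i - u j))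
      ≤ ∑ j, ∑ i, (e j * ρ D j i) * (u j * (u i - u j)))
    (ε : ℝ) (hε : 0 < ε) (f : Est J → ℝ)
    (hf : Summable (fun x : Est J => f x * f x * (p x.1 * q x.2)))
    (hc : Summable (fun k : ℕ => ∑' x : Est J, f x * (Tot ρ ν y ε)^[k+1] f x * (p x.1 * q x.2)))
    (hc' : Summable (fun k : ℕ => ∑' x : Est J, f x * (Tot ρ' ν y ε)^[k+1] f x * (p x.1 * q x.2))) :
    ∑' k : ℕ, ∑' x : Est J, f x * (Tot ρ' ν y ε)^[k+1] f x * (p x.1 * q x.2) ≤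
    ∑' k : ℕ, ∑' x : Est J, f x * (Tot ρ ν y ε)^[k+1] f x * (p x.1 * q x.2) := by
  have hw : ∀ x : Est J, 0 ≤ p x.1 * q x.2 := fun x => mul_nonneg (hp _).le (hq _)
  have hmem : ∀ (ρ : Finset (Fin J) → Option (Fin J) → Option (Fin J) → ℝ),
      ∀ f ∈ L2 (fun x : Est J => p x.1 * q x.2) hw,
      Tot ρ ν y ε f ∈ L2 (fun x : Est J => p x.1 * q x.2) hw := by
    intro ρ f hf
    exact (L2 _ hw).add_mem hf ((L2 _ hw).smul_mem ε
      ((L2 _ hw).add_mem (L2_Up hw he hsh hν ρ hf) (L2_Y hp hw y hf)))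
  have hpow : ∀ (ρ : Finset (Fin J) → Option (Fin J) → Option (Fin J) → ℝ)
      (v : L2 (fun x : Est J => p x.1 * q x.2) hw) (k : ℕ),
      ((((Tot ρ ν y ε).restrict (hmem ρ)) ^ k) v).1 = (Tot ρ ν y ε)^[k] v.1 := by
    intro ρ v k
    induction k with
    | zero => rfl
    | succ k ih =>
      rw [pow_succ', Module.End.mul_apply, Function.iterate_succ_apply', ← ih]
      rfl
  have hval : ∀ (ρ : Finset (Fin J) → Option (Fin J) → Option (Fin J) → ℝ)
      (g f : L2 (fun x : Est J => p x.1 * q x.2) hw),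
      ipB _ hw g ((Tot ρ ν y ε).restrict (hmem ρ) f) = ipB _ hw g f + ε *
       ((∑' x : Est J, (∑ j, ∑ i, (e j * ρ x.1 j i) * (g.1 (x.1, x.2 + eV j) *
      (f.1 (x.1, x.2 + eV i) - f.1 (x.1, x.2 + eV j)))) * (p x.1 * q x.2)) +
      ∑' n, (∑ D, ∑ E, (p D * y D E) * (g.1 (D, n) * (f.1 (E, n) - f.1 (D, n)))) * q n) := by
    intro ρ g f
    rw [(Up_hasSum hw he hsh hν ρ f.2 g.2).tsum_eq, ← Y_eq hp hw y f.2 g.2, ipB_apply, ipB_apply]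
    have s1 := L2_mul hw g.2 f.2
    have s2 := L2_mul hw g.2 (L2_Up hw he hsh hν ρ f.2)
    have s3 := L2_mul hw g.2 (L2_Y hp hw y f.2)
    rw [← s2.tsum_add s3, ← tsum_mul_left, ← s1.tsum_add ((s2.add s3).mul_left ε)]
    congr 1; ext x
    simp only [LinearMap.coe_restrict_apply, Tot, LinearMap.coe_mk, AddHom.coe_mk]
    ring
  have hsym : ∀ u v, ipB (fun x : Est J => p x.1 * q x.2) hw u v = ipB _ hw v u := by
    intro u v
    rw [ipB_apply, ipB_apply]
    congr 1; ext x; ring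
  have hTs : ∀ (ρ : Finset (Fin J) → Option (Fin J) → Option (Fin J) → ℝ),
      (∀ D i j, e i * ρ D i j = e j * ρ D j i) → ∀ u v,
      ipB _ hw ((Tot ρ ν y ε).restrict (hmem ρ) u) v =
      ipB _ hw u ((Tot ρ ν y ε).restrict (hmem ρ) v) := by
    intro ρ hr u v
    rw [hsym, hval, hval, hsym v u]
    congr 3
    · refine tsum_congr fun x => ?_
      rw [form_symm (fun j i => e j * ρ x.1 j i) (hr x.1)]
    · refine tsum_congr fun n => ?_
      rw [form_symm (fun D E => p D * y D E) hys (fun D => u.1 (D, n)) (fun D => v.1 (D, n))]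
  have main := abs_cmp (ipB (fun x : Est J => p x.1 * q x.2) hw) hsym
    (fun u => tsum_nonneg fun x => mul_nonneg (mul_self_nonneg _) (hw x))
    ((Tot ρ ν y ε).restrict (hmem ρ)) ((Tot ρ' ν y ε).restrict (hmem ρ'))
    (hTs ρ hr) (hTs ρ' hr')
    (by
      intro u
      rw [hval]
      have a1 : (∑' x : Est J, (∑ j, ∑ i, (e j * ρ x.1 j i) * (u.1 (x.1, x.2 + eV j) *
        (u.1 (x.1, x.2 + eV i) - u.1 (x.1, x.2 + eV j)))) * (p x.1 * q x.2)) ≤ 0 :=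
        tsum_nonpos fun x => mul_nonpos_of_nonpos_of_nonneg (form_nonpos
          (fun j i => e j * ρ x.1 j i) (hr x.1) (fun i j => mul_nonneg (he _).le (h0 _ _ _))
          (fun o => u.1 (x.1, x.2 + eV o))) (hw x)
      have a2 : (∑' n, (∑ D, ∑ E, (p D * y D E) * (u.1 (D, n) * (u.1 (E, n) - u.1 (D, n)))) * q n) ≤ 0 :=
        tsum_nonpos fun n => mul_nonpos_of_nonpos_of_nonneg (form_nonpos
          (fun D E => p D * y D E) hys (fun i j => mul_nonneg (hp _).le (hy0 _ _))
          (fun D => u.1 (D, n))) (hq n)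
      nlinarith)
    (by
      intro u
      rw [hval, hval]
      have s1 := (Up_hasSum hw he hsh hν ρ' u.2 u.2).summable
      have s2 := (Up_hasSum hw he hsh hν ρ u.2 u.2).summable
      have : (∑' x : Est J, (∑ j, ∑ i, (e j * ρ' x.1 j i) * (u.1 (x.1, x.2 + eV j) *
        (u.1 (x.1, x.2 + eV i) - u.1 (x.1, x.2 + eV j)))) * (p x.1 * q x.2)) ≤
        (∑' x : Est J, (∑ j, ∑ i, (e j * ρ x.1 j i) * (u.1 (x.1, x.2 + eV j) *
        (u.1 (x.1, x.2 + eV i) - u.1 (x.1, x.2 + eV j)))) * (p x.1 * q x.2)) := by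
        refine Summable.tsum_le_tsum (fun x => ?_) s1 s2
        exact mul_le_mul_of_nonneg_right (hcmp x.1 (fun o => u.1 (x.1, x.2 + eV o))) (hw x)
      have h3 := mul_le_mul_of_nonneg_left this hε.le
      rw [mul_add, mul_add]
      linarith)
    ⟨f, hf⟩
    (by simpa only [ipB_apply, hpow] using hc) (by simpa only [ipB_apply, hpow] using hc')
  simpa only [ipB_apply, hpow] using main

end total

def rhoE {J : ℕ} (r : Finset (Fin J) → Option (Fin J) → Option (Fin J) → ℝ) :
    Finset (Fin J) → Option (Fin J) → Option (Fin J) → ℝ :=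
  fun D j i => if j ∈ ext J D ∧ i ∈ ext J D then r D j i else 0

def nuE {J : ℕ} (lam : ℝ) (μ : Fin J → ℕ → ℝ) : Option (Fin J) → Est J → ℝ :=
  fun o x => o.elim lam (fun j => μ j (x.2 j))

theorem none_mem_ext {J : ℕ} (D : Finset (Fin J)) : none ∈ ext J D := by simp [ext]

theorem some_mem_ext {J : ℕ} (D : Finset (Fin J)) (j : Fin J) : some j ∈ ext J D ↔ j ∈ Dᶜ := by
  simp [ext]

theorem rhoE_sum {J : ℕ} (r : Finset (Fin J) → Option (Fin J) → Option (Fin J) → ℝ)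
    (D : Finset (Fin J)) (F : Option (Fin J) → Option (Fin J) → ℝ) :
    ∑ j, ∑ i, rhoE r D j i * F j i = ∑ j ∈ ext J D, ∑ i ∈ ext J D, r D j i * F j i := by
  rw [← Finset.sum_subset (Finset.subset_univ (ext J D))]
  · refine Finset.sum_congr rfl fun j hj => ?_
    rw [← Finset.sum_subset (Finset.subset_univ (ext J D))]
    · refine Finset.sum_congr rfl fun i hi => ?_
      simp [rhoE, hi, hj]
    · intro i _ hi
      simp [rhoE, hi]
  · intro j _ hj
    simp [rhoE, hj]

theorem ext_sum {J : ℕ} (D : Finset (Fin J)) (F : Option (Fin J) → ℝ) :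
    ∑ j ∈ ext J D, F j = F none + ∑ j ∈ Dᶜ, F (some j) := by
  unfold ext
  rw [Finset.sum_insert (by simp), Finset.sum_image (by simp)]

theorem eV_none {J : ℕ} : (eV none : Fin J → ℕ) = 0 := rfl

theorem QZ_eq {J : ℕ} (lam : ℝ) (μ : Fin J → ℕ → ℝ)
    (r : Finset (Fin J) → Option (Fin J) → Option (Fin J) → ℝ)
    (A B : Finset (Fin J) → ℝ) (f : Est J → ℝ) (x : Est J) :
    QZ lam μ r A B f x = Up (rhoE r) (nuE lam μ) f x + Yo (qY0 A B) f x := by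
  unfold QZ
  have h1 : Up (rhoE r) (nuE lam μ) f x =
    (∑ j ∈ x.1ᶜ, lam * r x.1 none (some j) * (f (x.1, x.2 + eV (some j)) - f x))
    + (∑ j ∈ x.1ᶜ, μ j (x.2 j) * r x.1 (some j) none * (f (x.1, x.2 - eV (some j)) - f x))
    + (∑ j ∈ x.1ᶜ, ∑ i ∈ x.1ᶜ,
        μ j (x.2 j) * r x.1 (some j) (some i) *
          (f (x.1, x.2 - eV (some j) + eV (some i)) - f x)) := by
    unfold Up
    rw [rhoE_sum r x.1 (fun j i => nuE lam μ j x * f (x.1, x.2 - eV j + eV i) - nuE lam μ j x * f x)]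
    simp only [ext_sum, eV_none, nuE, Option.elim, tsub_zero, add_zero, Prod.mk.eta, sub_self,
      mul_zero, zero_add, Finset.sum_add_distrib]
    rw [← add_assoc]
    congr 1
    · rw [add_comm]
      congr 1
      · refine Finset.sum_congr rfl fun j _ => ?_
        ring
      · refine Finset.sum_congr rfl fun j _ => ?_
        ring
    · refine Finset.sum_congr rfl fun j _ => Finset.sum_congr rfl fun i _ => ?_
      ring
  have h2 : Yo (qY0 A B) f x =
    (∑ H ∈ Finset.univ.filter (fun H => H ⊂ x.1), B x.1 / B H * (f (H, x.2) - f x))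
    + ∑ I ∈ Finset.univ.filter (fun I => x.1 ⊂ I), A I / A x.1 * (f (I, x.2) - f x) := by
    unfold Yo qY0
    rw [Finset.sum_filter, Finset.sum_filter, ← Finset.sum_add_distrib]
    refine Finset.sum_congr rfl fun E _ => ?_
    by_cases h : x.1 ⊂ E
    · have : ¬ E ⊂ x.1 := fun h' => (h.trans h').ne rfl
      simp [h, this]
    · by_cases h' : E ⊂ x.1 <;> simp [h, h']
  rw [h1, h2]
  ring

theorem piX_shift {J : ℕ} (η : Fin J → ℝ) (μ : Fin J → ℕ → ℝ)
    (hμpos : ∀ j k, k ≠ 0 → 0 < μ j k) (j : Fin J) (n : Fin J → ℕ) :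
    μ j (n j + 1) * piX η μ (n + eV (some j)) = η j * piX η μ n := by
  unfold piX
  rw [← Finset.mul_prod_erase _ _ (Finset.mem_univ j), ← Finset.mul_prod_erase _ _ (Finset.mem_univ j)]
  have : ∏ k ∈ Finset.univ.erase j, prodK η μ k ((n + eV (some j)) k) / Cnorm η μ k
      = ∏ k ∈ Finset.univ.erase j, prodK η μ k (n k) / Cnorm η μ k := by
    refine Finset.prod_congr rfl fun k hk => ?_
    have : k ≠ j := Finset.ne_of_mem_erase hk
    simp [eV, this]
  rw [this]
  have h1 : (n + eV (some j)) j = n j + 1 := by simp [eV]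
  rw [h1]
  have h2 : prodK η μ j (n j + 1) = prodK η μ j (n j) * (η j / μ j (n j + 1)) := by
    unfold prodK; rw [Finset.prod_range_succ]
  rw [h2]
  have := (hμpos j (n j + 1) (by omega)).ne'
  calc _ = (μ j (n j + 1) * (η j / μ j (n j + 1))) * (prodK η μ j (n j) / Cnorm η μ j *
        ∏ k ∈ Finset.univ.erase j, prodK η μ k (n k) / Cnorm η μ k) := by ring
    _ = _ := by rw [mul_div_cancel₀ _ this]

theorem shift_all {J : ℕ} (lam : ℝ) (η : Fin J → ℝ) (μ : Fin J → ℕ → ℝ)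
    (hμ0 : ∀ j, μ j 0 = 0)
    (hμpos : ∀ j k, k ≠ 0 → 0 < μ j k) (p : Finset (Fin J) → ℝ)
    (o : Option (Fin J)) (G : Est J → ℝ) (a : ℝ) :
      HasSum (fun x : Est J => nuE lam μ o x * G x * (p x.1 * piX η μ x.2)) a ↔
      HasSum (fun x : Est J => etaE lam η o * G (x.1, x.2 + eV o) * (p x.1 * piX η μ x.2)) a := by
  cases o with
  | none => simp [nuE, etaE, eV_none]
  | some j =>
    have hinj : Function.Injective (fun x : Est J => ((x.1, x.2 + eV (some j)) : Est J)) := by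
      rintro ⟨a, b⟩ ⟨c, d⟩ h
      simpa using h
    rw [← hinj.hasSum_iff]
    · refine iff_of_eq (congrArg (fun F => HasSum F a) ?_)
      ext x
      have h1 : (x.2 + eV (some j)) j = x.2 j + 1 := by simp [eV]
      simp only [Function.comp, nuE, etaE, Option.elim, h1]
      have := piX_shift η μ hμpos j x.2
      calc _ = (μ j (x.2 j + 1) * piX η μ (x.2 + eV (some j))) * G (x.1, x.2 + eV (some j)) * p x.1 := by ring
        _ = _ := by rw [this]; ring
    · rintro ⟨D, n⟩ hx
      have : n j = 0 := by
        by_contra h0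
        apply hx
        refine ⟨(D, n - eV (some j)), ?_⟩
        simp only [Prod.mk.injEq, true_and]
        ext k
        by_cases hk : k = j
        · subst hk; simp [eV]; omega
        · simp [eV, hk]
      simp [nuE, this, hμ0]

theorem cmp_form {J : ℕ} (lam : ℝ) (hlam : 0 < lam) (η : Fin J → ℝ) (hη : ∀ j, 0 < η j)
    (r r' : Finset (Fin J) → Option (Fin J) → Option (Fin J) → ℝ) (D : Finset (Fin J))
    (hrsto : ∀ i ∈ ext J D, ∑ j ∈ ext J D, r D i j = 1)
    (hrsto' : ∀ i ∈ ext J D, ∑ j ∈ ext J D, r' D i j = 1)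
    (hpsd : ∀ u : Option (Fin J) → ℝ,
      0 ≤ ∑ j ∈ ext J D, xiV lam η D j * u j *
            ∑ i ∈ ext J D, (r D j i - r' D j i) * u i) (hS : 0 < ∑ k ∈ ext J D, etaE lam η k)
    (u : Option (Fin J) → ℝ) :
    ∑ j, ∑ i, (etaE lam η j * rhoE r' D j i) * (u j * (u i - u j))
      ≤ ∑ j, ∑ i, (etaE lam η j * rhoE r D j i) * (u j * (u i - u j)) := by
  have key : ∀ (r : Finset (Fin J) → Option (Fin J) → Option (Fin J) → ℝ),
      (∀ i ∈ ext J D, ∑ j ∈ ext J D, r D i j = 1) →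
      ∑ j, ∑ i, (etaE lam η j * rhoE r D j i) * (u j * (u i - u j)) =
      ∑ j ∈ ext J D, etaE lam η j * u j * ((∑ i ∈ ext J D, r D j i * u i) - u j) := by
    intro r hr
    have := rhoE_sum r D (fun j i => etaE lam η j * (u j * (u i - u j)))
    have h2 : ∑ j, ∑ i, (etaE lam η j * rhoE r D j i) * (u j * (u i - u j)) =
        ∑ j, ∑ i, rhoE r D j i * (etaE lam η j * (u j * (u i - u j))) := by
      refine Finset.sum_congr rfl fun j _ => Finset.sum_congr rfl fun i _ => ?_
      ring
    rw [h2, this]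
    refine Finset.sum_congr rfl fun j hj => ?_
    have h3 : u j = ∑ i ∈ ext J D, r D j i * u j := by rw [← Finset.sum_mul, hr j hj, one_mul]
    conv_rhs => rw [mul_sub]; rhs; rhs; rw [h3]
    rw [← mul_sub, ← Finset.sum_sub_distrib, Finset.mul_sum]
    refine Finset.sum_congr rfl fun i _ => ?_
    ring
  rw [key r hrsto, key r' hrsto', ← sub_nonneg, ← Finset.sum_sub_distrib]
  have h := mul_nonneg hS.le (hpsd u)
  rw [Finset.mul_sum] at h
  refine h.trans_eq (Finset.sum_congr rfl fun j _ => ?_)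
  unfold xiV
  simp only [sub_mul, Finset.sum_sub_distrib]
  have := hS.ne'
  field_simp
  ring

theorem etaE_pos {J : ℕ} (lam : ℝ) (hlam : 0 < lam) (η : Fin J → ℝ) (hη : ∀ j, 0 < η j)
    (o : Option (Fin J)) : 0 < etaE lam η o := by
  cases o with
  | none => exact hlam
  | some j => exact hη j

theorem rev_form {J : ℕ} (lam : ℝ) (η : Fin J → ℝ)
    (r : Finset (Fin J) → Option (Fin J) → Option (Fin J) → ℝ) (D : Finset (Fin J))
    (hS : 0 < ∑ k ∈ ext J D, etaE lam η k)
    (hrev : ∀ i ∈ ext J D, ∀ j ∈ ext J D,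
      xiV lam η D i * r D i j = xiV lam η D j * r D j i) (i j : Option (Fin J)) :
    etaE lam η i * rhoE r D i j = etaE lam η j * rhoE r D j i := by
  unfold rhoE
  by_cases hi : i ∈ ext J D <;> by_cases hj : j ∈ ext J D <;> simp [hi, hj]
  have := hrev i hi j hj
  unfold xiV at this
  have h0 := hS.ne'
  field_simp at this
  exact this

end aux

/-- comparison of asymptotic variances for the one-step chains
`K = Id + εQ^Z` and `K' = Id + εQ^{Z'}` under reversibility of the routings
w.r.t. `ξ^D` and positive semidefiniteness of `R^D − R'^D` in `L²(ξ^D)`. -/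
theorem asymptotic_variance_comparison
    (J : ℕ) (hJ : 1 ≤ J)
    (lam : ℝ) (hlam : 0 < lam)
    (μ : Fin J → ℕ → ℝ)
    (hμ0 : ∀ j, μ j 0 = 0)
    (hμpos : ∀ j k, k ≠ 0 → 0 < μ j k)
    (hμbdd : ∃ M : ℝ, ∀ j k, μ j k ≤ M)
    (r : Finset (Fin J) → Option (Fin J) → Option (Fin J) → ℝ)
    (hrnn : ∀ D : Finset (Fin J), ∀ i ∈ ext J D, ∀ j ∈ ext J D, 0 ≤ r D i j)
    (hrsto : ∀ D : Finset (Fin J), ∀ i ∈ ext J D, ∑ j ∈ ext J D, r D i j = 1)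
    (η : Fin J → ℝ) (hη : ∀ j, 0 < η j)
    (htraffic : ∀ D : Finset (Fin J), ∀ j ∈ Dᶜ,
      η j = lam * r D none (some j) + ∑ i ∈ Dᶜ, η i * r D (some i) (some j))
    (r' : Finset (Fin J) → Option (Fin J) → Option (Fin J) → ℝ)
    (hrnn' : ∀ D : Finset (Fin J), ∀ i ∈ ext J D, ∀ j ∈ ext J D, 0 ≤ r' D i j)
    (hrsto' : ∀ D : Finset (Fin J), ∀ i ∈ ext J D, ∑ j ∈ ext J D, r' D i j = 1)
    (htraffic' : ∀ D : Finset (Fin J), ∀ j ∈ Dᶜ,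
      η j = lam * r' D none (some j) + ∑ i ∈ Dᶜ, η i * r' D (some i) (some j))
    (A B : Finset (Fin J) → ℝ)
    (hApos : ∀ D, 0 < A D) (hBpos : ∀ D, 0 < B D)
    (hA0 : A (∅ : Finset (Fin J)) = 1) (hB0 : B (∅ : Finset (Fin J)) = 1)
    (hC : ∀ j, Summable (fun k => prodK η μ j k))
    (hrev : ∀ D : Finset (Fin J), ∀ i ∈ ext J D, ∀ j ∈ ext J D,
      xiV lam η D i * r D i j = xiV lam η D j * r D j i)
    (hrev' : ∀ D : Finset (Fin J), ∀ i ∈ ext J D, ∀ j ∈ ext J D,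
      xiV lam η D i * r' D i j = xiV lam η D j * r' D j i)
    (hpsd : ∀ D : Finset (Fin J), ∀ u : Option (Fin J) → ℝ,
      0 ≤ ∑ j ∈ ext J D, xiV lam η D j * u j *
            ∑ i ∈ ext J D, (r D j i - r' D j i) * u i)
    (ε : ℝ) (hε : 0 < ε)
    (hrate : ∀ x : Est J, 0 ≤ 1 - ε * ∑' y : Est J, qZ lam μ r A B x y)
    (hrate' : ∀ x : Est J, 0 ≤ 1 - ε * ∑' y : Est J, qZ lam μ r' A B x y)
    (f : Est J → ℝ)
    (hf : Summable (fun x : Est J => f x * f x * piZ η μ A B x))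
    (hmean : (∑' x : Est J, f x * piZ η μ A B x) = 0)
    (hser : Summable (fun k : ℕ =>
      ∑' x : Est J, f x * (Kop ε (QZ lam μ r A B))^[k + 1] f x * piZ η μ A B x))
    (hser' : Summable (fun k : ℕ =>
      ∑' x : Est J, f x * (Kop ε (QZ lam μ r' A B))^[k + 1] f x * piZ η μ A B x)) :
    (∑' x : Est J, f x * f x * piZ η μ A B x)
        + 2 * ∑' k : ℕ,
            ∑' x : Est J, f x * (Kop ε (QZ lam μ r' A B))^[k + 1] f x * piZ η μ A B x
      ≤ (∑' x : Est J, f x * f x * piZ η μ A B x)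
        + 2 * ∑' k : ℕ,
            ∑' x : Est J, f x * (Kop ε (QZ lam μ r A B))^[k + 1] f x * piZ η μ A B x := by

  obtain ⟨M, hM⟩ := hμbdd
  have hS : ∀ D, 0 < ∑ k ∈ ext J D, etaE lam η k := fun D =>
    Finset.sum_pos (fun o _ => etaE_pos lam hlam η hη o) ⟨none, none_mem_ext D⟩
  have hAB : ∀ D, 0 < A D / B D := fun D => div_pos (hApos D) (hBpos D)
  have hCh : 0 < Chat A B := Finset.sum_pos (fun D _ => hAB D) Finset.univ_nonempty
  have hp : ∀ D, 0 < piY A B D := fun D => div_pos (hAB D) hCh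
  have hK : ∀ j k, 0 ≤ prodK η μ j k := fun j k => Finset.prod_nonneg fun i _ =>
    div_nonneg (hη j).le (hμpos j (i+1) (by omega)).le
  have hq : ∀ n, 0 ≤ piX η μ n := fun n => Finset.prod_nonneg fun j _ =>
    div_nonneg (hK j _) (tsum_nonneg (hK j))
  have hν : ∀ o x, |nuE lam μ o x| ≤ max lam M := by
    intro o x
    cases o with
    | none => simp [nuE, abs_of_pos hlam]
    | some j =>
      have : 0 ≤ μ j (x.2 j) := by
        by_cases h : x.2 j = 0
        · rw [h, hμ0]
        · exact (hμpos j _ h).le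
      simp only [nuE, Option.elim, abs_of_nonneg this]
      exact (hM _ _).trans (le_max_right _ _)
  have hKop : ∀ r, Kop ε (QZ lam μ r A B) = Tot (rhoE r) (nuE lam μ) (qY0 A B) ε := by
    intro r
    ext f x
    simp only [Kop, QZ_eq, Tot, LinearMap.coe_mk, AddHom.coe_mk]
  simp only [hKop] at hser hser' ⊢
  have main := total_cmp (p := piY A B) (q := piX η μ) (ν := nuE lam μ) (e := etaE lam η)
    hp hq (etaE_pos lam hlam η hη) (shift_all lam η μ hμ0 hμpos (piY A B)) hν
    (rhoE r) (rhoE r') (qY0 A B)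
    (by
      intro D E
      unfold qY0
      split_ifs
      · exact (div_pos (hApos _) (hApos _)).le
      · exact (div_pos (hBpos _) (hBpos _)).le
      · exact le_rfl)
    (by
      intro D E
      have a1 := (hApos D).ne'
      have a2 := (hApos E).ne'
      have a3 := (hBpos D).ne'
      have a4 := (hBpos E).ne'
      have a5 := hCh.ne'
      unfold qY0 piY
      by_cases h : D ⊂ E
      · have : ¬ E ⊂ D := fun h' => (h.trans h').ne rfl
        simp only [h, this, if_true, if_false]
        field_simp
      · by_cases h' : E ⊂ D
        · simp only [h, h', if_true, if_false]
          field_simp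
        · simp only [h, h', if_false, mul_zero])
    (by
      intro D i j
      unfold rhoE
      split_ifs with h
      · exact hrnn D i h.1 j h.2
      · exact le_rfl)
    (fun D => rev_form lam η r D (hS D) (hrev D))
    (fun D => rev_form lam η r' D (hS D) (hrev' D))
    (fun D => cmp_form lam hlam η hη r r' D (hrsto D) (hrsto' D) (hpsd D) (hS D))
    ε hε f hf hser hser'
  have := mul_le_mul_of_nonneg_left main (zero_le_two (α := ℝ))
  exact add_le_add_right this _

end UnrelNet
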